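/- For every integer n ≥ 2 there exists a constant C_n > 0 such that for all N ≥ 1 and all s with 1/2 ≤ s < 1: if n = 2 then |h(2, s, N) − N²(1−s)²| ≤ C_2 ( N⁶ (1−s)⁴ + N⁴ (1−s)³ ), and if n ≥ 3 then |h(n, s, N)| ≤ C_n ( N^{n+4} (1−s)⁴ + N^{n+2} (1−s)³ ). -/

import Mathlib

open MeasureTheory Real Filter

noncomputable section

/-- The joint eigenangle density of `SO(2N+1)` on `[0,π]^N`. -/
def densitySO (N : ℕ) (θ : Fin N → ℝ) : ℝ :=
  (2 ^ (N ^ 2) / (π ^ N * N.factorial)) *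
    (∏ j : Fin N, ∏ k ∈ Finset.Ioi j, (Real.cos (θ k) - Real.cos (θ j)) ^ 2) *
    ∏ m : Fin N, Real.sin (θ m / 2) ^ 2

/-- `h(n, s, N)`: the `n`-th moment of the eigenvalue sum against the eigenangle density. -/
def hFun (n : ℕ) (s : ℝ) (N : ℕ) : ℝ :=
  ∫ θ in Set.univ.pi fun _ : Fin N => Set.Icc (0 : ℝ) π,
    ((s - 1) * ∑ j, (2 * s - 2 * Real.cos (θ j)) / (1 + s ^ 2 - 2 * s * Real.cos (θ j))) ^ n *
      densitySO N θ

/-- `g(l, s, N)`: the integral of `∏_j ((1-s)² + 4s sin²(θ_j/2))^{-l_j}` against the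
eigenangle density. -/
def gFun (N : ℕ) (l : Fin N → ℕ) (s : ℝ) : ℝ :=
  ∫ θ in Set.univ.pi fun _ : Fin N => Set.Icc (0 : ℝ) π,
    (∏ j, ((1 - s) ^ 2 + 4 * s * Real.sin (θ j / 2) ^ 2) ^ (-(l j : ℤ))) * densitySO N θ

/-- The odd half-integer sine `sin ((k + 1/2) x)`. -/
def halfSin (k : ℕ) (x : ℝ) : ℝ := Real.sin ((k + 1 / 2) * x)

@[fun_prop]
lemma continuous_halfSin (k : ℕ) : Continuous (halfSin k) := by
  unfold halfSin
  fun_prop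

lemma integral_cos_int_mul (m : ℤ) :
    ∫ x in (0 : ℝ)..π, Real.cos (m * x) = if m = 0 then π else 0 := by
  split_ifs with hm
  · simp [hm]
  · have hm' : (m : ℝ) ≠ 0 := by exact_mod_cast hm
    rw [intervalIntegral.integral_comp_mul_left (f := Real.cos) hm', integral_cos]
    simp [Real.sin_int_mul_pi]

lemma integral_halfSin_mul_halfSin (j k : ℕ) :
    ∫ x in Set.Icc (0 : ℝ) π, halfSin j x * halfSin k x = if j = k then π / 2 else 0 := by
  rw [integral_Icc_eq_integral_Ioc, ← intervalIntegral.integral_of_le pi_pos.le]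
  have hprod : ∀ x : ℝ, halfSin j x * halfSin k x =
      (Real.cos (((j - k : ℤ) : ℝ) * x) - Real.cos (((j + k + 1 : ℤ) : ℝ) * x)) / 2 := by
    intro x
    have h₁ : ((j - k : ℤ) : ℝ) * x = (j + 1 / 2) * x - (k + 1 / 2) * x := by push_cast; ring
    have h₂ : ((j + k + 1 : ℤ) : ℝ) * x = (j + 1 / 2) * x + (k + 1 / 2) * x := by push_cast; ring
    rw [h₁, h₂, Real.cos_sub, Real.cos_add, halfSin, halfSin]
    ring
  simp_rw [hprod]
  rw [intervalIntegral.integral_div, intervalIntegral.integral_sub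
    (Continuous.intervalIntegrable (by fun_prop) _ _)
    (Continuous.intervalIntegrable (by fun_prop) _ _),
    integral_cos_int_mul, integral_cos_int_mul]
  have h₁ : (j + k + 1 : ℤ) ≠ 0 := by omega
  have h₂ : ((j : ℤ) - k = 0) ↔ j = k := by omega
  simp only [h₁, h₂, if_false]
  split_ifs <;> ring

lemma abs_halfSin_le (k : ℕ) (x : ℝ) :
    |halfSin k x| ≤ (2 * k + 1) * |Real.sin (x / 2)| := by
  induction k with
  | zero => exact le_of_eq (by simp [halfSin]; ring_nf)
  | succ k ih =>
    have h₁ : halfSin (k + 1) x = halfSin k x * Real.cos x +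
        Real.cos ((k + 1 / 2) * x) * (2 * Real.sin (x / 2) * Real.cos (x / 2)) := by
      rw [← Real.sin_two_mul, mul_div_cancel₀ x two_ne_zero, halfSin, halfSin, ← Real.sin_add]
      push_cast
      ring_nf
    have h₂ : |halfSin k x * Real.cos x| ≤ |halfSin k x| := by
      rw [abs_mul]
      exact mul_le_of_le_one_right (abs_nonneg _) (Real.abs_cos_le_one _)
    have h₃ : |Real.cos ((k + 1 / 2) * x) * (2 * Real.sin (x / 2) * Real.cos (x / 2))| ≤
        2 * |Real.sin (x / 2)| := by
      simp only [abs_mul, abs_two]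
      calc _ ≤ 1 * (2 * |Real.sin (x / 2)| * 1) := by
            gcongr <;> exact Real.abs_cos_le_one _
        _ = _ := by ring
    have h₄ := abs_add_le (halfSin k x * Real.cos x)
      (Real.cos ((k + 1 / 2) * x) * (2 * Real.sin (x / 2) * Real.cos (x / 2)))
    rw [h₁]
    push_cast
    linarith

/-- `sin ((k + 1/2) x) / sin (x / 2)` is `2 ^ k` times a monic polynomial of degree `k`
in `cos x`. -/
lemma exists_monic_halfSin_eq (k : ℕ) :
    ∃ q : Polynomial ℝ, q.Monic ∧ q.natDegree = k ∧
      ∀ x, halfSin k x = Real.sin (x / 2) * (2 ^ k * q.eval (Real.cos x)) := by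
  induction k using Nat.strong_induction_on with
  | _ k ih =>
    match k with
    | 0 => exact ⟨1, Polynomial.monic_one, by simp, fun x => by simp [halfSin]; ring_nf⟩
    | 1 =>
      refine ⟨Polynomial.X + Polynomial.C (1 / 2), Polynomial.monic_X_add_C _,
        Polynomial.natDegree_X_add_C _, fun x => ?_⟩
      obtain ⟨y, rfl⟩ : ∃ y, x = 2 * y := ⟨x / 2, by ring⟩
      have h₁ : ((1 : ℕ) + 1 / 2 : ℝ) * (2 * y) = 3 * y := by push_cast; ring
      rw [halfSin, h₁, Real.sin_three_mul, mul_div_cancel_left₀ y two_ne_zero]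
      simp [Real.cos_two_mul, Real.cos_sq']
      ring
    | k + 2 =>
      obtain ⟨p, hpm, hpd, hp⟩ := ih k (by omega)
      obtain ⟨q, hqm, hqd, hq⟩ := ih (k + 1) (by omega)
      have hXm : (Polynomial.X * q).Monic := Polynomial.monic_X.mul hqm
      have hXd : (Polynomial.X * q).natDegree = k + 2 := by
        rw [Polynomial.natDegree_X_mul hqm.ne_zero, hqd]
      have hlt : (Polynomial.C (1 / 4) * p).natDegree < (Polynomial.X * q).natDegree := by
        have := Polynomial.natDegree_C_mul_le (1 / 4) p
        omega
      refine ⟨Polynomial.X * q - Polynomial.C (1 / 4) * p,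
        hXm.sub_of_left (Polynomial.degree_lt_degree hlt), ?_, fun x => ?_⟩
      · rw [Polynomial.natDegree_sub_eq_left_of_natDegree_lt hlt, hXd]
      · have hrec : halfSin (k + 2) x = 2 * Real.cos x * halfSin (k + 1) x - halfSin k x := by
          have h₁ : ((k + 2 : ℕ) + 1 / 2 : ℝ) * x = ((k + 1 : ℕ) + 1 / 2 : ℝ) * x + x := by
            push_cast; ring
          have h₂ : (k + 1 / 2 : ℝ) * x = ((k + 1 : ℕ) + 1 / 2 : ℝ) * x - x := by
            push_cast; ring
          rw [halfSin, halfSin, halfSin, h₁, h₂, Real.sin_add, Real.sin_sub]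
          ring
        rw [hrec, hp, hq]
        simp only [Polynomial.eval_sub, Polynomial.eval_mul, Polynomial.eval_X, Polynomial.eval_C]
        ring

lemma prod_two_pow_sq_mul (N : ℕ) :
    (∏ k : Fin N, (2 : ℝ) ^ (k : ℕ)) ^ 2 * 2 ^ N = 2 ^ (N ^ 2) := by
  rw [Fin.prod_univ_eq_prod_range (fun k => (2 : ℝ) ^ k)]
  induction N with
  | zero => simp
  | succ N ih =>
    have h : (N + 1) ^ 2 = N ^ 2 + (2 * N + 1) := by ring
    rw [Finset.prod_range_succ, h, pow_add _ (N ^ 2), ← ih]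
    ring

lemma densitySO_eq_det_sq (N : ℕ) (θ : Fin N → ℝ) :
    densitySO N θ = (2 / π) ^ N / N.factorial *
      (Matrix.of fun i j : Fin N => halfSin i (θ j)).det ^ 2 := by
  choose q hqm hqd hq using exists_monic_halfSin_eq
  have hV := Matrix.det_eval_matrixOfPolynomials_eq_det_vandermonde (fun j => Real.cos (θ j))
    (fun k : Fin N => q k) (fun k => hqd k) (fun k => hqm k)
  rw [Matrix.det_vandermonde, ← Matrix.det_transpose] at hV
  have hM : (Matrix.of fun i j : Fin N => halfSin i (θ j)).det =
      (∏ j, Real.sin (θ j / 2)) * ((∏ k : Fin N, (2 : ℝ) ^ (k : ℕ)) *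
        ∏ j : Fin N, ∏ k ∈ Finset.Ioi j, (Real.cos (θ k) - Real.cos (θ j))) := by
    rw [hV, ← Matrix.det_mul_column, ← Matrix.det_mul_row]
    congr 1
    ext i j
    simp [hq]
  rw [hM, densitySO, ← prod_two_pow_sq_mul, mul_pow, mul_pow]
  simp only [Finset.prod_pow]
  rw [div_pow]
  ring

lemma densitySO_nonneg (N : ℕ) (θ : Fin N → ℝ) : 0 ≤ densitySO N θ := by
  rw [densitySO_eq_det_sq]
  have := pi_pos
  positivity

lemma continuous_densitySO (N : ℕ) : Continuous (densitySO N) := by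
  unfold densitySO
  fun_prop

lemma integrableOn_pi_Icc {N : ℕ} {F : (Fin N → ℝ) → ℝ} (hF : Continuous F) :
    IntegrableOn F (Set.univ.pi fun _ : Fin N => Set.Icc (0 : ℝ) π) :=
  hF.continuousOn.integrableOn_compact (isCompact_univ_pi fun _ => isCompact_Icc)

/-- The one-point marginals of the eigenangle density. -/
lemma integral_apply_mul_densitySO {N : ℕ} (i : Fin N) {f : ℝ → ℝ} (hf : Continuous f) :
    ∫ θ in Set.univ.pi fun _ : Fin N => Set.Icc (0 : ℝ) π, f (θ i) * densitySO N θ =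
      (∑ σ : Equiv.Perm (Fin N),
        2 / π * ∫ x in Set.Icc (0 : ℝ) π, f x * halfSin (σ i) x ^ 2) / N.factorial := by
  set K := Set.univ.pi fun _ : Fin N => Set.Icc (0 : ℝ) π with hK
  let g : Equiv.Perm (Fin N) → Equiv.Perm (Fin N) → Fin N → ℝ → ℝ := fun σ τ j x =>
    (if j = i then f x else 1) * (halfSin (σ j) x * halfSin (τ j) x)
  have hg : ∀ σ τ j, Continuous (g σ τ j) := by
    intro σ τ j
    by_cases hj : j = i <;> simp only [g, hj, if_true, if_false] <;> fun_prop
  have hexp : ∀ θ : Fin N → ℝ, f (θ i) * densitySO N θ =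
      (2 / π) ^ N / N.factorial * ∑ σ : Equiv.Perm (Fin N), ∑ τ : Equiv.Perm (Fin N),
        ((Equiv.Perm.sign σ : ℤ) : ℝ) * ((Equiv.Perm.sign τ : ℤ) : ℝ) * ∏ j, g σ τ j (θ j) := by
    intro θ
    have hf' : f (θ i) = ∏ j, if j = i then f (θ j) else 1 := by simp
    rw [densitySO_eq_det_sq, Matrix.det_apply', sq, Finset.sum_mul_sum, mul_left_comm]
    simp only [Finset.mul_sum, g, Finset.prod_mul_distrib, ← hf', Matrix.of_apply]
    refine Finset.sum_congr rfl fun σ _ => Finset.sum_congr rfl fun τ _ => ?_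
    ring
  have hfubini : ∀ σ τ, ∫ θ in K, ∏ j, g σ τ j (θ j) = ∏ j, ∫ x in Set.Icc (0 : ℝ) π, g σ τ j x := by
    intro σ τ
    rw [hK, volume_pi, Measure.restrict_pi_pi]
    exact integral_fintype_prod_eq_prod (g σ τ)
  have hoff : ∀ σ τ, τ ≠ σ → ∏ j, ∫ x in Set.Icc (0 : ℝ) π, g σ τ j x = 0 := by
    intro σ τ hne
    obtain ⟨j, hji, hj⟩ : ∃ j, j ≠ i ∧ τ j ≠ σ j := by
      by_contra! hcon
      refine hne (Equiv.ext fun j => ?_)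
      by_cases hj : j = i
      · subst hj
        obtain ⟨k, hk⟩ := σ.surjective (τ j)
        by_cases hkj : k = j
        · rw [← hk, hkj]
        · rw [← hcon k hkj] at hk
          exact absurd (τ.injective hk) hkj
      · exact hcon j hj
    refine Finset.prod_eq_zero (Finset.mem_univ j) ?_
    simp only [g, hji, if_false, one_mul]
    rw [integral_halfSin_mul_halfSin, if_neg]
    exact fun h => hj (Fin.ext h).symm
  have hdiag : ∀ σ, ∏ j, ∫ x in Set.Icc (0 : ℝ) π, g σ σ j x =
      (π / 2) ^ (N - 1) * ∫ x in Set.Icc (0 : ℝ) π, f x * halfSin (σ i) x ^ 2 := by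
    intro σ
    rw [← Finset.mul_prod_erase _ _ (Finset.mem_univ i), mul_comm]
    congr 1
    · rw [Finset.prod_congr rfl (g := fun _ => π / 2)]
      · rw [Finset.prod_const, Finset.card_erase_of_mem (Finset.mem_univ i), Finset.card_univ,
          Fintype.card_fin]
      · intro j hj
        simp only [g, Finset.ne_of_mem_erase hj, if_false, one_mul]
        rw [integral_halfSin_mul_halfSin, if_pos rfl]
    · simp only [g, if_true, sq]
  have hprod_integrable : ∀ σ τ, IntegrableOn (fun θ : Fin N → ℝ => ∏ j, g σ τ j (θ j)) K := fun σ τ =>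
    integrableOn_pi_Icc (continuous_finsetProd _ fun j _ => (hg σ τ j).comp (continuous_apply j))
  simp_rw [hexp]
  rw [integral_const_mul, integral_finsetSum _ fun σ _ => integrable_finsetSum _ fun τ _ =>
    (hprod_integrable σ τ).const_mul _, Finset.mul_sum, Finset.sum_div]
  refine Finset.sum_congr rfl fun σ _ => ?_
  rw [integral_finsetSum _ fun τ _ => (hprod_integrable σ τ).const_mul _]
  simp_rw [integral_const_mul, hfubini]
  rw [Finset.sum_eq_single σ (fun τ _ hne => by rw [hoff σ τ hne, mul_zero]) (by simp), hdiag]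
  have hs : ((Equiv.Perm.sign σ : ℤ) : ℝ) * ((Equiv.Perm.sign σ : ℤ) : ℝ) = 1 := by
    rcases Int.units_eq_one_or (Equiv.Perm.sign σ) with h | h <;> simp [h]
  have hN : N = (N - 1) + 1 := by have := i.pos; omega
  have hpow : (2 / π) ^ N * (π / 2) ^ (N - 1) = 2 / π := by
    conv_lhs => rw [hN, Nat.add_sub_cancel]
    rw [pow_succ, mul_right_comm, ← mul_pow]
    have : 2 / π * (π / 2) = 1 := by field_simp
    rw [this, one_pow, one_mul]
  rw [hs, one_mul, ← mul_assoc, div_mul_eq_mul_div, hpow]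
  ring

lemma integral_densitySO {N : ℕ} (hN : 1 ≤ N) :
    ∫ θ in Set.univ.pi fun _ : Fin N => Set.Icc (0 : ℝ) π, densitySO N θ = 1 := by
  have h := integral_apply_mul_densitySO (⟨0, hN⟩ : Fin N) (f := fun _ => 1) continuous_const
  simp only [one_mul, sq, integral_halfSin_mul_halfSin, if_true] at h
  rw [h]
  have : 2 / π * (π / 2) = 1 := by field_simp
  rw [this, Finset.sum_const, Finset.card_univ, Fintype.card_perm, Fintype.card_fin, nsmul_one]
  exact div_self (Nat.cast_ne_zero.2 N.factorial_ne_zero)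

/-- The Poisson kernel denominator `|1 - s e^{ix}|²`. -/
def poissonDen (s x : ℝ) : ℝ := 1 + s ^ 2 - 2 * s * Real.cos x

lemma poissonDen_eq (s x : ℝ) :
    poissonDen s x = (1 - s) ^ 2 + 4 * s * Real.sin (x / 2) ^ 2 := by
  have h : Real.cos x = 1 - 2 * Real.sin (x / 2) ^ 2 := by
    rw [Real.sin_sq_eq_half_sub, mul_div_cancel₀ x two_ne_zero]
    ring
  rw [poissonDen, h]
  ring

lemma sq_one_sub_le_poissonDen {s : ℝ} (hs : 1 / 2 ≤ s) (x : ℝ) :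
    (1 - s) ^ 2 ≤ poissonDen s x := by
  rw [poissonDen_eq]
  have : 0 ≤ 4 * s * Real.sin (x / 2) ^ 2 := by positivity
  linarith

lemma two_mul_sin_sq_le_poissonDen {s : ℝ} (hs : 1 / 2 ≤ s) (x : ℝ) :
    2 * Real.sin (x / 2) ^ 2 ≤ poissonDen s x := by
  rw [poissonDen_eq]
  nlinarith [sq_nonneg (1 - s), sq_nonneg (Real.sin (x / 2))]

lemma poissonDen_pos {s : ℝ} (hs : 1 / 2 ≤ s) (hs1 : s < 1) (x : ℝ) : 0 < poissonDen s x :=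
  (pow_pos (sub_pos.2 hs1) 2).trans_le (sq_one_sub_le_poissonDen hs x)

lemma continuous_inv_poissonDen {s : ℝ} (hs : 1 / 2 ≤ s) (hs1 : s < 1) :
    Continuous fun x => (poissonDen s x)⁻¹ := by
  refine Continuous.inv₀ ?_ fun x => (poissonDen_pos hs hs1 x).ne'
  unfold poissonDen
  fun_prop

lemma integral_inv_poissonDen_le {s : ℝ} (hs : 1 / 2 ≤ s) (hs1 : s < 1) :
    ∫ x in Set.Icc (0 : ℝ) π, (poissonDen s x)⁻¹ ≤ 9 * (π / 2) / (1 - s) := by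
  set ε := 1 - s with hε
  have hε0 : 0 < ε := sub_pos.2 hs1
  have hlow : ∀ x ∈ Set.Icc (0 : ℝ) π,
      (poissonDen s x)⁻¹ ≤ 9 / ε ^ 2 * (1 + (x / ε) ^ 2)⁻¹ := by
    intro x hx
    have hsin : x / π ≤ Real.sin (x / 2) := by
      have := Real.mul_le_sin (x := x / 2) (by linarith [hx.1]) (by linarith [hx.2])
      calc x / π = 2 / π * (x / 2) := by ring
        _ ≤ _ := this
    have hx9 : x ^ 2 / 18 ≤ Real.sin (x / 2) ^ 2 := by
      have h₁ : (x / π) ^ 2 ≤ Real.sin (x / 2) ^ 2 :=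
        pow_le_pow_left₀ (div_nonneg hx.1 pi_pos.le) hsin 2
      have h₂ : π ^ 2 ≤ 18 := by nlinarith [pi_le_four, pi_pos]
      rw [div_pow] at h₁
      exact (div_le_div_of_nonneg_left (sq_nonneg x) (by positivity) h₂).trans h₁
    have h₁ : (ε ^ 2 + x ^ 2) / 9 ≤ poissonDen s x := by
      rw [poissonDen_eq, ← hε]
      nlinarith [sq_nonneg ε, sq_nonneg x]
    calc (poissonDen s x)⁻¹ ≤ ((ε ^ 2 + x ^ 2) / 9)⁻¹ := inv_anti₀ (by positivity) h₁
      _ = _ := by field_simp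
  calc ∫ x in Set.Icc (0 : ℝ) π, (poissonDen s x)⁻¹
      ≤ ∫ x in Set.Icc (0 : ℝ) π, 9 / ε ^ 2 * (1 + (x / ε) ^ 2)⁻¹ := by
        refine setIntegral_mono_on (continuous_inv_poissonDen hs hs1).integrableOn_Icc
          (Continuous.integrableOn_Icc ?_) measurableSet_Icc hlow
        exact continuous_const.mul (Continuous.inv₀ (by fun_prop) fun x => by positivity)
    _ = 9 / ε ^ 2 * (ε * Real.arctan (π / ε)) := by
        rw [integral_const_mul, integral_Icc_eq_integral_Ioc,
          ← intervalIntegral.integral_of_le pi_pos.le,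
          intervalIntegral.integral_comp_div (f := fun y => (1 + y ^ 2)⁻¹) hε0.ne',
          integral_inv_one_add_sq]
        simp
    _ ≤ 9 / ε ^ 2 * (ε * (π / 2)) := by
        gcongr
        exact (Real.arctan_lt_pi_div_two _).le
    _ = _ := by field_simp

lemma integral_apply_mul_densitySO_le {N : ℕ} (i : Fin N) {f : ℝ → ℝ} (hf : Continuous f) {B : ℝ}
    (hB : ∀ k < N, 2 / π * ∫ x in Set.Icc (0 : ℝ) π, f x * halfSin k x ^ 2 ≤ B) :
    ∫ θ in Set.univ.pi fun _ : Fin N => Set.Icc (0 : ℝ) π, f (θ i) * densitySO N θ ≤ B := by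
  rw [integral_apply_mul_densitySO i hf, div_le_iff₀ (by positivity)]
  calc _ ≤ ∑ _σ : Equiv.Perm (Fin N), B := Finset.sum_le_sum fun σ _ => hB (σ i) (σ i).2
    _ = B * N.factorial := by
      rw [Finset.sum_const, Finset.card_univ, Fintype.card_perm, Fintype.card_fin, nsmul_eq_mul,
        mul_comm]

lemma inv_poissonDen_pow_succ_mul_halfSin_sq_le {s : ℝ} (hs : 1 / 2 ≤ s) (hs1 : s < 1)
    {k N : ℕ} (hk : k < N) (m : ℕ) (x : ℝ) :
    (poissonDen s x)⁻¹ ^ (m + 1) * halfSin k x ^ 2 ≤ 2 * N ^ 2 * (poissonDen s x)⁻¹ ^ m := by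
  have hD := poissonDen_pos hs hs1 x
  have h₁ : halfSin k x ^ 2 ≤ 2 * N ^ 2 * poissonDen s x := by
    have hkN : (2 * k + 1 : ℝ) ≤ 2 * N := by exact_mod_cast (by omega : 2 * k + 1 ≤ 2 * N)
    calc halfSin k x ^ 2 = |halfSin k x| ^ 2 := (sq_abs _).symm
      _ ≤ (2 * N * |Real.sin (x / 2)|) ^ 2 := by
        gcongr
        exact (abs_halfSin_le k x).trans (by gcongr)
      _ = 2 * N ^ 2 * (2 * Real.sin (x / 2) ^ 2) := by rw [mul_pow, sq_abs]; ring
      _ ≤ _ := by gcongr; exact two_mul_sin_sq_le_poissonDen hs x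
  calc _ ≤ (poissonDen s x)⁻¹ ^ (m + 1) * (2 * N ^ 2 * poissonDen s x) := by gcongr
    _ = _ := by rw [pow_succ]; field_simp

lemma integral_inv_poissonDen_pow_mul_densitySO_le {s : ℝ} (hs : 1 / 2 ≤ s) (hs1 : s < 1)
    {N : ℕ} (i : Fin N) (m : ℕ) {J : ℝ}
    (hJ : ∫ x in Set.Icc (0 : ℝ) π, (poissonDen s x)⁻¹ ^ m ≤ J) :
    ∫ θ in Set.univ.pi fun _ : Fin N => Set.Icc (0 : ℝ) π,
      (poissonDen s (θ i))⁻¹ ^ (m + 1) * densitySO N θ ≤ 2 / π * (2 * N ^ 2 * J) := by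
  have hc := continuous_inv_poissonDen hs hs1
  have hpi := pi_pos
  refine integral_apply_mul_densitySO_le i (hc.pow (m + 1)) fun k hk => ?_
  gcongr
  calc _ ≤ ∫ x in Set.Icc (0 : ℝ) π, 2 * N ^ 2 * (poissonDen s x)⁻¹ ^ m :=
        integral_mono (Continuous.integrableOn_Icc (by fun_prop))
          (Continuous.integrableOn_Icc (by fun_prop))
          (inv_poissonDen_pow_succ_mul_halfSin_sq_le hs hs1 hk m)
    _ ≤ _ := by rw [integral_const_mul]; gcongr

section Moments

variable {s : ℝ} {N : ℕ}

lemma integral_inv_poissonDen_mul_densitySO_le (hs : 1 / 2 ≤ s) (hs1 : s < 1) (i : Fin N) :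
    ∫ θ in Set.univ.pi fun _ : Fin N => Set.Icc (0 : ℝ) π,
      (poissonDen s (θ i))⁻¹ ^ 1 * densitySO N θ ≤ 4 * N ^ 2 := by
  refine (integral_inv_poissonDen_pow_mul_densitySO_le hs hs1 i 0 (J := π) ?_).trans_eq ?_
  · simp [pi_pos.le]
  · field_simp
    ring

lemma integral_inv_poissonDen_sq_mul_densitySO_le (hs : 1 / 2 ≤ s) (hs1 : s < 1) (i : Fin N) :
    ∫ θ in Set.univ.pi fun _ : Fin N => Set.Icc (0 : ℝ) π,
      (poissonDen s (θ i))⁻¹ ^ 2 * densitySO N θ ≤ 18 * N ^ 2 / (1 - s) := by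
  refine (integral_inv_poissonDen_pow_mul_densitySO_le hs hs1 i 1
    (J := 9 * (π / 2) / (1 - s)) ?_).trans_eq ?_
  · simpa using integral_inv_poissonDen_le hs hs1
  · field_simp
    ring

lemma integral_inv_poissonDen_cube_mul_densitySO_le (hs : 1 / 2 ≤ s) (hs1 : s < 1) (i : Fin N) :
    ∫ θ in Set.univ.pi fun _ : Fin N => Set.Icc (0 : ℝ) π,
      (poissonDen s (θ i))⁻¹ ^ 3 * densitySO N θ ≤ 18 * N ^ 2 / (1 - s) ^ 3 := by
  have hε : 0 < 1 - s := sub_pos.2 hs1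
  have hc := continuous_inv_poissonDen hs hs1
  refine (integral_inv_poissonDen_pow_mul_densitySO_le hs hs1 i 2
    (J := ((1 - s) ^ 2)⁻¹ * (9 * (π / 2) / (1 - s))) ?_).trans_eq ?_
  · calc _ ≤ ∫ x in Set.Icc (0 : ℝ) π, ((1 - s) ^ 2)⁻¹ * (poissonDen s x)⁻¹ := by
          refine integral_mono (Continuous.integrableOn_Icc (by fun_prop))
            (Continuous.integrableOn_Icc (by fun_prop)) fun x => ?_
          have hD := poissonDen_pos hs hs1 x
          simp only [sq (poissonDen s x)⁻¹]
          gcongr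
          exact sq_one_sub_le_poissonDen hs x
      _ ≤ _ := by
          rw [integral_const_mul]
          gcongr
          exact integral_inv_poissonDen_le hs hs1
  · field_simp
    ring

end Moments

/-- The eigenvalue sum whose moments are `hFun`, in terms of the Poisson kernel. -/
lemma eigenSum_eq {s : ℝ} (hs : 1 / 2 ≤ s) (hs1 : s < 1) {N : ℕ} (θ : Fin N → ℝ) :
    (s - 1) * ∑ j, (2 * s - 2 * Real.cos (θ j)) / (1 + s ^ 2 - 2 * s * Real.cos (θ j)) =
      -((1 - s) / s) * (N - (1 - s ^ 2) * ∑ j, (poissonDen s (θ j))⁻¹) := by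
  have hs0 : s ≠ 0 := by linarith
  have hterm : ∀ j, (2 * s - 2 * Real.cos (θ j)) / (1 + s ^ 2 - 2 * s * Real.cos (θ j)) =
      s⁻¹ * (1 - (1 - s ^ 2) * (poissonDen s (θ j))⁻¹) := by
    intro j
    have hD := (poissonDen_pos hs hs1 (θ j)).ne'
    rw [← poissonDen]
    field_simp
    rw [poissonDen]
    ring
  simp_rw [hterm]
  rw [← Finset.mul_sum, Finset.sum_sub_distrib, ← Finset.mul_sum]
  simp
  ring

lemma one_sub_div_le {s : ℝ} (hs : 1 / 2 ≤ s) (hs1 : s < 1) : (1 - s) / s ≤ 2 * (1 - s) := by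
  rw [div_le_iff₀ (by linarith)]
  nlinarith

lemma abs_eigenSum_sq_sub_le {s : ℝ} (hs : 1 / 2 ≤ s) (hs1 : s < 1) {N : ℕ} (θ : Fin N → ℝ) :
    |((s - 1) * ∑ j, (2 * s - 2 * Real.cos (θ j)) /
        (1 + s ^ 2 - 2 * s * Real.cos (θ j))) ^ 2 - (N : ℝ) ^ 2 * (1 - s) ^ 2| ≤
      8 * (1 - s) ^ 3 * N ^ 2 + 16 * (1 - s) ^ 3 * N * ∑ j, (poissonDen s (θ j))⁻¹ ^ 1 +
        16 * (1 - s) ^ 4 * N * ∑ j, (poissonDen s (θ j))⁻¹ ^ 2 := by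
  rw [eigenSum_eq hs hs1]
  simp only [pow_one]
  set S := ∑ j, (poissonDen s (θ j))⁻¹ with hS
  have hS0 : 0 ≤ S := Finset.sum_nonneg fun j _ => (inv_pos.2 (poissonDen_pos hs hs1 _)).le
  have hSq : S ^ 2 ≤ N * ∑ j, (poissonDen s (θ j))⁻¹ ^ 2 := by
    simpa using sq_sum_le_card_mul_sum_sq (s := Finset.univ)
      (f := fun j => (poissonDen s (θ j))⁻¹)
  set a := (1 - s) / s with ha
  set ε := 1 - s with hε
  have hε0 : 0 < ε := sub_pos.2 hs1
  have ha0 : 0 ≤ a := div_nonneg hε0.le (by linarith)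
  have ha2 : a ≤ 2 * ε := one_sub_div_le hs hs1
  have hasub : 0 ≤ a - ε ∧ a - ε ≤ 2 * ε ^ 2 := by
    have : a - ε = a * ε := by
      have hs0 : s ≠ 0 := by linarith
      rw [ha]
      field_simp
      rw [hε]
    rw [this]
    exact ⟨by positivity, by nlinarith⟩
  have hb0 : 0 ≤ 1 - s ^ 2 := by nlinarith
  have hb2 : 1 - s ^ 2 ≤ 2 * ε := by rw [hε]; nlinarith
  set b := 1 - s ^ 2
  have h₁ : |(a ^ 2 - ε ^ 2) * (N : ℝ) ^ 2| ≤ 8 * ε ^ 3 * N ^ 2 := by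
    have : a ^ 2 - ε ^ 2 = (a - ε) * (a + ε) := by ring
    rw [this, abs_of_nonneg (by have := hasub.1; positivity)]
    refine mul_le_mul_of_nonneg_right ?_ (sq_nonneg _)
    calc (a - ε) * (a + ε) ≤ 2 * ε ^ 2 * (4 * ε) := by
          gcongr
          · exact hasub.2
          · linarith
      _ = _ := by ring
  have h₂ : |2 * a ^ 2 * b * N * S| ≤ 16 * ε ^ 3 * N * S := by
    rw [abs_of_nonneg (by positivity)]
    calc _ ≤ 2 * (2 * ε) ^ 2 * (2 * ε) * N * S := by gcongr
      _ = _ := by ring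
  have h₃ : |a ^ 2 * b ^ 2 * S ^ 2| ≤ 16 * ε ^ 4 * N * ∑ j, (poissonDen s (θ j))⁻¹ ^ 2 := by
    rw [abs_of_nonneg (by positivity)]
    calc _ ≤ (2 * ε) ^ 2 * (2 * ε) ^ 2 * (N * ∑ j, (poissonDen s (θ j))⁻¹ ^ 2) := by gcongr
      _ = _ := by ring
  calc _ = |(a ^ 2 - ε ^ 2) * (N : ℝ) ^ 2 - 2 * a ^ 2 * b * N * S + a ^ 2 * b ^ 2 * S ^ 2| := by
        congr 1
        ring
    _ ≤ |(a ^ 2 - ε ^ 2) * (N : ℝ) ^ 2| + |2 * a ^ 2 * b * N * S| + |a ^ 2 * b ^ 2 * S ^ 2| :=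
        (abs_add_le _ _).trans (by gcongr; exact abs_sub _ _)
    _ ≤ _ := by gcongr

lemma abs_eigenSum_pow_le {s : ℝ} (hs : 1 / 2 ≤ s) (hs1 : s < 1) {N : ℕ} (θ : Fin N → ℝ) (n : ℕ) :
    |((s - 1) * ∑ j, (2 * s - 2 * Real.cos (θ j)) /
        (1 + s ^ 2 - 2 * s * Real.cos (θ j))) ^ (n + 3)| ≤
      (6 * N) ^ n * (32 * (1 - s) ^ 3 * N ^ 3 +
        256 * (1 - s) ^ 6 * N ^ 2 * ∑ j, (poissonDen s (θ j))⁻¹ ^ 3) := by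
  rw [eigenSum_eq hs hs1]
  set S := ∑ j, (poissonDen s (θ j))⁻¹ with hS
  have hinv : ∀ j, 0 ≤ (poissonDen s (θ j))⁻¹ := fun j =>
    (inv_pos.2 (poissonDen_pos hs hs1 _)).le
  have hS0 : 0 ≤ S := Finset.sum_nonneg fun j _ => hinv j
  have hcube : S ^ 3 ≤ N ^ 2 * ∑ j, (poissonDen s (θ j))⁻¹ ^ 3 := by
    simpa using pow_sum_le_card_mul_sum_pow (s := Finset.univ) (fun j _ => hinv j) 2
  set ε := 1 - s with hε
  have hε0 : 0 < ε := sub_pos.2 hs1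
  have hSle : S ≤ N * (ε ^ 2)⁻¹ := by
    calc S ≤ ∑ _j : Fin N, (ε ^ 2)⁻¹ := Finset.sum_le_sum fun j _ =>
          inv_anti₀ (by positivity) (sq_one_sub_le_poissonDen hs _)
      _ = _ := by simp
  have hX : |-(ε / s) * (N - (1 - s ^ 2) * S)| ≤ 2 * ε * N + 4 * ε ^ 2 * S := by
    have hb0 : 0 ≤ 1 - s ^ 2 := by nlinarith
    have hb2 : 1 - s ^ 2 ≤ 2 * ε := by rw [hε]; nlinarith
    have ha0 : 0 ≤ ε / s := div_nonneg hε0.le (by linarith)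
    rw [abs_mul, abs_neg, abs_of_nonneg ha0]
    calc _ ≤ 2 * ε * (N + 2 * ε * S) := by
          gcongr
          · exact one_sub_div_le hs hs1
          · refine (abs_sub _ _).trans ?_
            rw [abs_of_nonneg (by positivity : (0 : ℝ) ≤ N), abs_of_nonneg (by positivity)]
            gcongr
      _ = _ := by ring
  set X := -(ε / s) * (N - (1 - s ^ 2) * S)
  have hX6 : |X| ≤ 6 * N := by
    have h₁ : ε ≤ 1 := by linarith
    have h₂ : ε ^ 2 * S ≤ (N : ℝ) := by
      calc ε ^ 2 * S ≤ ε ^ 2 * (N * (ε ^ 2)⁻¹) := by gcongr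
        _ = (N : ℝ) := by field_simp
    have h₃ : ε * N ≤ N := mul_le_of_le_one_left (by positivity) h₁
    linarith
  have hX3 : |X| ^ 3 ≤ 32 * ε ^ 3 * N ^ 3 +
      256 * ε ^ 6 * N ^ 2 * ∑ j, (poissonDen s (θ j))⁻¹ ^ 3 := by
    calc |X| ^ 3 ≤ (2 * ε * N + 4 * ε ^ 2 * S) ^ 3 := by gcongr
      _ ≤ 2 ^ (3 - 1) * ((2 * ε * N) ^ 3 + (4 * ε ^ 2 * S) ^ 3) :=
        add_pow_le (by positivity) (by positivity) 3
      _ = 32 * ε ^ 3 * N ^ 3 + 256 * ε ^ 6 * S ^ 3 := by ring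
      _ ≤ 32 * ε ^ 3 * N ^ 3 +
          256 * ε ^ 6 * (N ^ 2 * ∑ j, (poissonDen s (θ j))⁻¹ ^ 3) := by gcongr
      _ = _ := by ring
  rw [abs_pow, pow_add]
  gcongr

lemma continuous_sum_inv_poissonDen_pow {s : ℝ} (hs : 1 / 2 ≤ s) (hs1 : s < 1) (N m : ℕ) :
    Continuous fun θ : Fin N → ℝ => ∑ j, (poissonDen s (θ j))⁻¹ ^ m :=
  continuous_finsetSum _ fun j _ =>
    ((continuous_inv_poissonDen hs hs1).comp (continuous_apply j)).pow m

lemma integral_sum_inv_poissonDen_pow_mul_densitySO_le {s : ℝ} (hs : 1 / 2 ≤ s) (hs1 : s < 1)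
    {N m : ℕ} {B : ℝ}
    (hB : ∀ i : Fin N, ∫ θ in Set.univ.pi fun _ : Fin N => Set.Icc (0 : ℝ) π,
      (poissonDen s (θ i))⁻¹ ^ m * densitySO N θ ≤ B) :
    ∫ θ in Set.univ.pi fun _ : Fin N => Set.Icc (0 : ℝ) π,
      (∑ j, (poissonDen s (θ j))⁻¹ ^ m) * densitySO N θ ≤ N * B := by
  have hc := continuous_inv_poissonDen hs hs1
  have hd := continuous_densitySO N
  simp_rw [Finset.sum_mul]
  rw [integral_finsetSum _ fun j _ => integrableOn_pi_Icc
    (((hc.comp' (continuous_apply j)).fun_pow m).fun_mul hd)]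
  calc _ ≤ ∑ _j : Fin N, B := Finset.sum_le_sum fun j _ => hB j
    _ = _ := by simp

lemma continuous_eigenSum {s : ℝ} (hs : 1 / 2 ≤ s) (hs1 : s < 1) (N : ℕ) :
    Continuous fun θ : Fin N → ℝ =>
      (s - 1) * ∑ j, (2 * s - 2 * Real.cos (θ j)) / (1 + s ^ 2 - 2 * s * Real.cos (θ j)) := by
  refine continuous_const.mul (continuous_finsetSum _ fun j _ => ?_)
  exact Continuous.div (by fun_prop) (by fun_prop) fun θ => (poissonDen_pos hs hs1 (θ j)).ne'

lemma abs_hFun_two_sub_le {s : ℝ} (hs : 1 / 2 ≤ s) (hs1 : s < 1) {N : ℕ} (hN : 1 ≤ N) :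
    |hFun 2 s N - (N : ℝ) ^ 2 * (1 - s) ^ 2| ≤ 360 * ((N : ℝ) ^ 4 * (1 - s) ^ 3) := by
  have hε : 0 < 1 - s := sub_pos.2 hs1
  have hN1 : (1 : ℝ) ≤ N := by exact_mod_cast hN
  have hd := continuous_densitySO N
  have hc₁ := continuous_sum_inv_poissonDen_pow hs hs1 N 1
  have hc₂ := continuous_sum_inv_poissonDen_pow hs hs1 N 2
  have hX := continuous_eigenSum hs hs1 N
  have hsub : hFun 2 s N - (N : ℝ) ^ 2 * (1 - s) ^ 2 =
      ∫ θ in Set.univ.pi fun _ : Fin N => Set.Icc (0 : ℝ) π,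
        (((s - 1) * ∑ j, (2 * s - 2 * Real.cos (θ j)) /
          (1 + s ^ 2 - 2 * s * Real.cos (θ j))) ^ 2 - (N : ℝ) ^ 2 * (1 - s) ^ 2) *
            densitySO N θ := by
    simp_rw [sub_mul _ _ (densitySO N _)]
    rw [integral_sub (integrableOn_pi_Icc (by fun_prop)) (integrableOn_pi_Icc (by fun_prop)),
      integral_const_mul, integral_densitySO hN, mul_one, hFun]
  have h₁ := integral_sum_inv_poissonDen_pow_mul_densitySO_le hs hs1
    (integral_inv_poissonDen_mul_densitySO_le (N := N) hs hs1)
  have h₂ := integral_sum_inv_poissonDen_pow_mul_densitySO_le hs hs1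
    (integral_inv_poissonDen_sq_mul_densitySO_le (N := N) hs hs1)
  calc |hFun 2 s N - (N : ℝ) ^ 2 * (1 - s) ^ 2|
      ≤ ∫ θ in Set.univ.pi fun _ : Fin N => Set.Icc (0 : ℝ) π,
        (8 * (1 - s) ^ 3 * N ^ 2 * densitySO N θ +
          16 * (1 - s) ^ 3 * N * ((∑ j, (poissonDen s (θ j))⁻¹ ^ 1) * densitySO N θ) +
          16 * (1 - s) ^ 4 * N * ((∑ j, (poissonDen s (θ j))⁻¹ ^ 2) * densitySO N θ)) := by
        rw [hsub, ← Real.norm_eq_abs]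
        refine norm_integral_le_of_norm_le (integrableOn_pi_Icc (by fun_prop))
          (Eventually.of_forall fun θ => ?_)
        have h := mul_le_mul_of_nonneg_right (abs_eigenSum_sq_sub_le hs hs1 θ)
          (densitySO_nonneg N θ)
        rw [Real.norm_eq_abs, abs_mul, abs_of_nonneg (densitySO_nonneg N θ)]
        exact h.trans_eq (by ring)
    _ = 8 * (1 - s) ^ 3 * N ^ 2 +
          16 * (1 - s) ^ 3 * N * (∫ θ in Set.univ.pi fun _ : Fin N => Set.Icc (0 : ℝ) π,
            (∑ j, (poissonDen s (θ j))⁻¹ ^ 1) * densitySO N θ) +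
          16 * (1 - s) ^ 4 * N * ∫ θ in Set.univ.pi fun _ : Fin N => Set.Icc (0 : ℝ) π,
            (∑ j, (poissonDen s (θ j))⁻¹ ^ 2) * densitySO N θ := by
        rw [integral_add (integrableOn_pi_Icc (by fun_prop)) (integrableOn_pi_Icc (by fun_prop)),
          integral_add (integrableOn_pi_Icc (by fun_prop)) (integrableOn_pi_Icc (by fun_prop)),
          integral_const_mul, integral_const_mul, integral_const_mul, integral_densitySO hN,
          mul_one]
    _ ≤ 8 * (1 - s) ^ 3 * N ^ 4 + 16 * (1 - s) ^ 3 * N * (N * (4 * N ^ 2)) +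
          16 * (1 - s) ^ 4 * N * (N * (18 * N ^ 2 / (1 - s))) := by
        gcongr
        norm_num
    _ = _ := by
        field_simp
        ring

lemma abs_hFun_add_three_le {s : ℝ} (hs : 1 / 2 ≤ s) (hs1 : s < 1) {N : ℕ} (hN : 1 ≤ N) (n : ℕ) :
    |hFun (n + 3) s N| ≤ 6 ^ n * 4640 * ((N : ℝ) ^ (n + 5) * (1 - s) ^ 3) := by
  have hε : 0 < 1 - s := sub_pos.2 hs1
  have hN1 : (1 : ℝ) ≤ N := by exact_mod_cast hN
  have hd := continuous_densitySO N
  have hc₃ := continuous_sum_inv_poissonDen_pow hs hs1 N 3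
  have h₃ := integral_sum_inv_poissonDen_pow_mul_densitySO_le hs hs1
    (integral_inv_poissonDen_cube_mul_densitySO_le (N := N) hs hs1)
  calc |hFun (n + 3) s N|
      ≤ ∫ θ in Set.univ.pi fun _ : Fin N => Set.Icc (0 : ℝ) π,
        (6 * N) ^ n * (32 * (1 - s) ^ 3 * N ^ 3 * densitySO N θ +
          256 * (1 - s) ^ 6 * N ^ 2 *
            ((∑ j, (poissonDen s (θ j))⁻¹ ^ 3) * densitySO N θ)) := by
        rw [hFun, ← Real.norm_eq_abs]
        refine norm_integral_le_of_norm_le (integrableOn_pi_Icc (by fun_prop))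
          (Eventually.of_forall fun θ => ?_)
        have h := mul_le_mul_of_nonneg_right (abs_eigenSum_pow_le hs hs1 θ n)
          (densitySO_nonneg N θ)
        rw [Real.norm_eq_abs, abs_mul, abs_of_nonneg (densitySO_nonneg N θ)]
        exact h.trans_eq (by ring)
    _ = (6 * N) ^ n * (32 * (1 - s) ^ 3 * N ^ 3 +
          256 * (1 - s) ^ 6 * N ^ 2 * ∫ θ in Set.univ.pi fun _ : Fin N => Set.Icc (0 : ℝ) π,
            (∑ j, (poissonDen s (θ j))⁻¹ ^ 3) * densitySO N θ) := by
        rw [integral_const_mul, integral_add (integrableOn_pi_Icc (by fun_prop))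
          (integrableOn_pi_Icc (by fun_prop)), integral_const_mul, integral_const_mul,
          integral_densitySO hN, mul_one]
    _ ≤ (6 * N) ^ n * (32 * (1 - s) ^ 3 * N ^ 5 +
          256 * (1 - s) ^ 6 * N ^ 2 * (N * (18 * N ^ 2 / (1 - s) ^ 3))) := by
        gcongr
        norm_num
    _ = _ := by
        field_simp
        ring

/-- Bounds on `h(n, s, N)` for `n ≥ 2`. -/
theorem hFun_bound_of_two_le (n : ℕ) (hn : 2 ≤ n) :
    ∃ C : ℝ, 0 < C ∧ ∀ (N : ℕ), 1 ≤ N → ∀ (s : ℝ), 1 / 2 ≤ s → s < 1 →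
      (n = 2 →
        |hFun 2 s N - (N : ℝ) ^ 2 * (1 - s) ^ 2| ≤
          C * ((N : ℝ) ^ 6 * (1 - s) ^ 4 + (N : ℝ) ^ 4 * (1 - s) ^ 3)) ∧
      (3 ≤ n →
        |hFun n s N| ≤ C * ((N : ℝ) ^ (n + 4) * (1 - s) ^ 4 + (N : ℝ) ^ (n + 2) * (1 - s) ^ 3)) := by
  obtain ⟨m, rfl | rfl⟩ : ∃ m, n = 2 ∨ n = m + 3 :=
    ⟨n - 3, by omega⟩
  · refine ⟨360, by norm_num, fun N hN s hs hs1 => ⟨fun _ => ?_, fun h => by omega⟩⟩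
    have hε : 0 < 1 - s := sub_pos.2 hs1
    refine (abs_hFun_two_sub_le hs hs1 hN).trans ?_
    gcongr
    exact le_add_of_nonneg_left (by positivity)
  · refine ⟨6 ^ m * 4640, by positivity, fun N hN s hs hs1 => ⟨fun h => by omega, fun _ => ?_⟩⟩
    have hε : 0 < 1 - s := sub_pos.2 hs1
    refine (abs_hFun_add_three_le hs hs1 hN m).trans ?_
    gcongr
    exact le_add_of_nonneg_left (by positivity)
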